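/- Let n ∈ ℕ₀, let ν, μ ∈ ℂ with Re ν > −1/2 and Re μ > −1/2, and let x ∈ (−1,1). Then the connection relation 𝖯_{n+ν}^{−ν}(x) = (2^{ν−μ} n! (1−x²)^{(ν−μ)/2} / Γ(2ν+n+1)) · Σ_{k=0}^{⌊n/2⌋} (μ+n−2k+1/2) ((ν−μ)_k Γ(ν+1/2+n−k) Γ(2μ+n−2k+1) / (k! (n−2k)! Γ(μ+3/2+n−k))) 𝖯_{n−2k+μ}^{−μ}(x) holds. -/

import Mathlib

/-- Pochhammer symbol `(a)_k = a (a+1) ⋯ (a+k-1)` for complex `a`. -/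
noncomputable def cpoch (a : ℂ) (k : ℕ) : ℂ := ∏ i ∈ Finset.range k, (a + i)

/-- Gauss hypergeometric series `₂F₁(a, b; c; z)`. -/
noncomputable def hyp2F1 (a b c z : ℂ) : ℂ :=
  ∑' k : ℕ, cpoch a k * cpoch b k / (cpoch c k * (Nat.factorial k : ℂ)) * z ^ k

/-- Ferrers function of the first kind `𝖯_ν^{−μ}(x)`. -/
noncomputable def ferrersP (ν μ : ℂ) (x : ℝ) : ℂ :=
  (1 / Complex.Gamma (μ + 1)) * (((1 - x) / (1 + x) : ℝ) : ℂ) ^ (μ / 2) *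
    hyp2F1 (-ν) (ν + 1) (μ + 1) (((1 - x) / 2 : ℝ) : ℂ)

open Finset Filter Topology

@[simp] lemma cpoch_zero (a : ℂ) : cpoch a 0 = 1 := by simp [cpoch]

@[simp] lemma cpoch_one (a : ℂ) : cpoch a 1 = a := by simp [cpoch]

lemma cpoch_succ (a : ℂ) (k : ℕ) : cpoch a (k + 1) = cpoch a k * (a + k) := by
  simp [cpoch, prod_range_succ]

lemma cpoch_succ' (a : ℂ) (k : ℕ) : cpoch a (k + 1) = a * cpoch (a + 1) k := by
  simp only [cpoch, prod_range_succ', Nat.cast_zero, add_zero, mul_comm a]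
  congr 1
  refine prod_congr rfl fun i _ => ?_
  push_cast
  ring

lemma add_natCast_ne_zero {a : ℂ} (ha : 0 < a.re) (k : ℕ) : a + k ≠ 0 := by
  intro h
  have h_re := congrArg Complex.re h
  simp only [Complex.add_re, Complex.natCast_re, Complex.zero_re] at h_re
  have : (0 : ℝ) ≤ k := k.cast_nonneg
  linarith

lemma cpoch_ne_zero {a : ℂ} (ha : 0 < a.re) (k : ℕ) : cpoch a k ≠ 0 :=
  prod_ne_zero_iff.2 fun i _ => add_natCast_ne_zero ha i

lemma Gamma_add_natCast {a : ℂ} (ha : 0 < a.re) (k : ℕ) :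
    Complex.Gamma (a + k) = Complex.Gamma a * cpoch a k := by
  induction k with
  | zero => simp
  | succ k ih =>
    rw [cpoch_succ, ← mul_assoc, ← ih, mul_comm,
      ← Complex.Gamma_add_one _ (add_natCast_ne_zero ha k)]
    push_cast
    ring_nf

/-- The `k`-th term of the Gauss hypergeometric series. -/
noncomputable def hypTerm (a b c z : ℂ) (k : ℕ) : ℂ :=
  cpoch a k * cpoch b k / (cpoch c k * (Nat.factorial k : ℂ)) * z ^ k

lemma hypTerm_succ (a b c z : ℂ) (k : ℕ) :
    hypTerm a b c z (k + 1) =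
      (a + k) * (b + k) / ((c + k) * (1 + k)) * z * hypTerm a b c z k := by
  simp only [hypTerm, cpoch_succ, Nat.factorial_succ, pow_succ, div_eq_mul_inv, mul_inv]
  push_cast
  rw [add_comm (1 : ℂ) k]
  simp only [mul_inv]
  ring

lemma tendsto_add_natCast_div (a c : ℂ) :
    Tendsto (fun k : ℕ => (a + k) / (c + k)) atTop (𝓝 1) := by
  simpa using tendsto_add_mul_div_add_mul_atTop_nhds a c (1 : ℂ) one_ne_zero

lemma summable_hypTerm (a b c : ℂ) {z : ℂ} (hz : ‖z‖ < 1) : Summable (hypTerm a b c z) := by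
  obtain ⟨r, hzr, hr⟩ := exists_between hz
  have hlim : Tendsto (fun k : ℕ => ‖(a + k) * (b + k) / ((c + k) * (1 + k)) * z‖)
      atTop (𝓝 ‖z‖) := by
    have := (((tendsto_add_natCast_div a c).mul (tendsto_add_natCast_div b 1)).mul_const z).norm
    simpa [div_mul_div_comm] using this
  refine summable_of_ratio_norm_eventually_le hr ?_
  filter_upwards [hlim.eventually_le_const hzr] with k hk
  rw [hypTerm_succ, norm_mul]
  gcongr

lemma hyp2F1_cancel {a c z : ℂ} (hc : 0 < c.re) (hz : ‖z‖ < 1) :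
    hyp2F1 (-a) c c z = (1 - z) ^ a := by
  have h := (Complex.one_div_one_sub_cpow_hasFPowerSeriesOnBall_zero (-a)).hasSum
    (y := z) (by simpa [enorm_eq_nnnorm, ← NNReal.coe_lt_coe] using hz)
  rw [zero_add, Complex.cpow_neg, one_div, inv_inv] at h
  rw [← h.tsum_eq, hyp2F1]
  refine tsum_congr fun k => ?_
  have hasc : (ascPochhammer ℕ k).smeval (-a) = cpoch (-a) k := by
    rw [Polynomial.ascPochhammer_smeval_eq_eval]
    induction k with
    | zero => simp
    | succ k ih => rw [ascPochhammer_succ_eval, ih, cpoch_succ]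
  have hk : (k.factorial : ℂ) ≠ 0 := by exact_mod_cast k.factorial_ne_zero
  have hmul := Ring.factorial_nsmul_multichoose_eq_ascPochhammer (-a) k
  rw [hasc, nsmul_eq_mul] at hmul
  have hcp := cpoch_ne_zero hc k
  simp only [FormalMultilinearSeries.ofScalars_apply_eq, Ring.choose, smul_eq_mul]
  rw [show -a + k - 1 - k + 1 = -a by ring, ← hmul]
  field_simp

lemma hypTerm_contiguous (N c z : ℂ) (hc : 0 < c.re) (m : ℕ) :
    (N + c) * hypTerm (-(N + 1)) (N + 2) c z (m + 1) =
      (2 * N + 1) * (hypTerm (-N) (N + 1) c z (m + 1) - 2 * z * hypTerm (-N) (N + 1) c z m) -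
        (N + 1 - c) * hypTerm (-(N - 1)) N c z (m + 1) := by
  have hc0 : c ≠ 0 := by simpa using add_natCast_ne_zero hc 0
  cases m with
  | zero =>
    simp [hypTerm]
    field_simp
    ring
  | succ m =>
    have hA : cpoch (-(N + 1)) (m + 2) = (-(N + 1)) * (-N * cpoch (-N + 1) m) := by
      rw [cpoch_succ', cpoch_succ']; ring_nf
    have hA₁ : cpoch (-N) (m + 2) = -N * (cpoch (-N + 1) m * (-N + 1 + m)) := by
      rw [cpoch_succ', cpoch_succ]
    have hA₂ : cpoch (-N) (m + 1) = -N * cpoch (-N + 1) m := cpoch_succ' _ _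
    have hA₃ : cpoch (-(N - 1)) (m + 2) =
        cpoch (-N + 1) m * (-N + 1 + m) * (-N + 1 + (m + 1)) := by
      rw [cpoch_succ, cpoch_succ]; push_cast; ring_nf
    have hB : cpoch (N + 2) (m + 2) = cpoch (N + 2) m * (N + 2 + m) * (N + 2 + (m + 1)) := by
      rw [cpoch_succ, cpoch_succ]; push_cast; ring_nf
    have hB₁ : cpoch (N + 1) (m + 2) = (N + 1) * (cpoch (N + 2) m * (N + 2 + m)) := by
      rw [cpoch_succ', cpoch_succ]; ring_nf
    have hB₂ : cpoch (N + 1) (m + 1) = (N + 1) * cpoch (N + 2) m := by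
      rw [cpoch_succ']; ring_nf
    have hB₃ : cpoch N (m + 2) = N * ((N + 1) * cpoch (N + 2) m) := by
      rw [cpoch_succ', cpoch_succ']; ring_nf
    have hcm := cpoch_ne_zero hc (m + 1)
    have hcm' : c + (m + 1 : ℂ) ≠ 0 := by exact_mod_cast add_natCast_ne_zero hc (m + 1)
    have hf : ((m + 1).factorial : ℂ) ≠ 0 := by exact_mod_cast (m + 1).factorial_ne_zero
    have hm : (m + 1 + 1 : ℂ) ≠ 0 := by exact_mod_cast (m + 1).succ_ne_zero
    simp only [hypTerm, Nat.add_assoc m 1 1, Nat.reduceAdd, hA, hA₁, hA₂, hA₃, hB, hB₁, hB₂, hB₃]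
    rw [cpoch_succ c (m + 1), Nat.factorial_succ (m + 1), pow_succ z (m + 1)]
    push_cast
    field_simp
    ring

lemma hyp2F1_contiguous (N c : ℂ) {z : ℂ} (hc : 0 < c.re) (hz : ‖z‖ < 1) :
    (N + c) * hyp2F1 (-(N + 1)) (N + 2) c z =
      (2 * N + 1) * (1 - 2 * z) * hyp2F1 (-N) (N + 1) c z -
        (N + 1 - c) * hyp2F1 (-(N - 1)) N c z := by
  have hs₁ := summable_hypTerm (-(N + 1)) (N + 2) c hz
  have hs₂ := summable_hypTerm (-N) (N + 1) c hz
  have hs₃ := summable_hypTerm (-(N - 1)) N c hz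
  have h₁ := ((summable_nat_add_iff 1).2 hs₁).hasSum.mul_left (N + c)
  have h₂ := ((((summable_nat_add_iff 1).2 hs₂).hasSum.sub
    (hs₂.hasSum.mul_left (2 * z))).mul_left (2 * N + 1)).sub
      (((summable_nat_add_iff 1).2 hs₃).hasSum.mul_left (N + 1 - c))
  have h := h₁.unique (h₂.congr_fun fun m => hypTerm_contiguous N c z hc m)
  change (N + c) * ∑' k, hypTerm (-(N + 1)) (N + 2) c z k =
      (2 * N + 1) * (1 - 2 * z) * ∑' k, hypTerm (-N) (N + 1) c z k -
        (N + 1 - c) * ∑' k, hypTerm (-(N - 1)) N c z k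
  have h_zero : ∀ a b : ℂ, hypTerm a b c z 0 = 1 := fun a b => by simp [hypTerm]
  have e₂ := hs₂.tsum_eq_zero_add
  rw [h_zero] at e₂
  rw [hs₁.tsum_eq_zero_add, hs₃.tsum_eq_zero_add, h_zero, h_zero]
  linear_combination h + (2 * N + 1) * (-e₂)

/-- The Gegenbauer polynomials, defined by their three-term recurrence. -/
noncomputable def gegenbauer (l x : ℂ) : ℕ → ℂ
  | 0 => 1
  | 1 => 2 * l * x
  | n + 2 =>
    (2 * (n + 1 + l) * x * gegenbauer l x (n + 1) - (n + 2 * l) * gegenbauer l x n) / (n + 2)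

lemma gegenbauer_rec (l x : ℂ) (n : ℕ) :
    (n + 2) * gegenbauer l x (n + 2) =
      2 * (n + 1 + l) * x * gegenbauer l x (n + 1) - (n + 2 * l) * gegenbauer l x n := by
  have : (n + 2 : ℂ) ≠ 0 := by exact_mod_cast (n + 1).succ_ne_zero
  rw [gegenbauer, mul_div_cancel₀ _ this]

lemma hyp2F1_eq_gegenbauer (ν : ℂ) (hν : -(1 / 2 : ℝ) < ν.re) {z : ℂ} (hz : ‖z‖ < 1) (n : ℕ) :
    cpoch (2 * ν + 1) n * hyp2F1 (-(n + ν)) (n + ν + 1) (ν + 1) z =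
      (1 - z) ^ ν * n.factorial * gegenbauer (ν + 1 / 2) (1 - 2 * z) n := by
  have hν₁ : 0 < (ν + 1).re := by simp; linarith
  have hν₂ : 0 < (2 * ν + 1).re := by simp; linarith
  induction n using Nat.twoStepInduction with
  | zero => simp [gegenbauer, hyp2F1_cancel hν₁ hz]
  | one =>
    have h := hyp2F1_contiguous ν (ν + 1) hν₁ hz
    rw [hyp2F1_cancel hν₁ hz] at h
    simp only [cpoch_succ, cpoch_zero, gegenbauer, Nat.factorial]
    push_cast
    rw [show (1 : ℂ) + ν = ν + 1 by ring, show ν + 1 + 1 = ν + 2 by ring]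
    linear_combination h
  | more n ih₀ ih₁ =>
    have h := hyp2F1_contiguous (n + 1 + ν) (ν + 1) hν₁ hz
    have hg := gegenbauer_rec (ν + 1 / 2) (1 - 2 * z) n
    rw [cpoch_succ] at ih₁ ⊢
    rw [cpoch_succ]
    simp only [Nat.factorial_succ] at ih₁ ⊢
    push_cast at ih₁ ⊢
    rw [show (n + 1 + ν - 1 : ℂ) = n + ν by ring, show (n + 1 + ν + 1 : ℂ) = n + 2 + ν by ring,
      show (n + 1 + ν + 2 : ℂ) = n + 2 + ν + 1 by ring, show (n + 1 + ν : ℂ) = n + ν + 1 by ring] at h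
    rw [show (n + 1 + ν + 1 : ℂ) = n + 2 + ν by ring, show (n + 1 + ν : ℂ) = n + ν + 1 by ring]
      at ih₁
    linear_combination cpoch (2 * ν + 1) n * (2 * ν + 1 + n) * h +
      (2 * (n + ν + 1) + 1) * (1 - 2 * z) * ih₁ - (n + 1) * (2 * ν + 1 + n) * ih₀ -
      (1 - z) ^ ν * (n + 1) * n.factorial * hg

/-- The coefficient of `gegenbauer m x j` in the expansion of `gegenbauer l x (j + 2 * k)`. -/
noncomputable def gegenbauerCoeff (l m : ℂ) (j k : ℕ) : ℂ :=
  (m + j) * cpoch l (j + k) * cpoch (l - m) k / (k.factorial * cpoch m (j + k + 1))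

lemma gegenbauerCoeff_rec (l : ℂ) {m : ℂ} (hm : 0 < m.re) (j k : ℕ) :
    (j + 2 * k + 3) * gegenbauerCoeff l m (j + 1) (k + 1) =
      (j + 2 * k + 2 + l) * ((j + 1) / (j + m) * gegenbauerCoeff l m j (k + 1) +
        (j + 1 + 2 * m) / (j + 2 + m) * gegenbauerCoeff l m (j + 2) k) -
        (j + 2 * k + 1 + 2 * l) * gegenbauerCoeff l m (j + 1) k := by
  have h₁ := cpoch_ne_zero hm (j + k + 1)
  have h₂ := add_natCast_ne_zero hm (j + k + 1)
  have h₃ := add_natCast_ne_zero hm (j + k + 2)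
  have h₄ := add_natCast_ne_zero hm j
  have h₅ := add_natCast_ne_zero hm (j + 2)
  have h₆ : (k.factorial : ℂ) ≠ 0 := by exact_mod_cast k.factorial_ne_zero
  have h₇ : (k + 1 : ℂ) ≠ 0 := by exact_mod_cast k.succ_ne_zero
  simp only [gegenbauerCoeff, Nat.factorial_succ, cpoch_succ _ k,
    show j + 1 + (k + 1) = j + k + 1 + 1 by ring, show j + (k + 1) = j + k + 1 by ring,
    show j + 2 + k = j + k + 1 + 1 by ring, show j + 1 + k = j + k + 1 by ring,
    cpoch_succ m (j + k + 1), cpoch_succ m (j + k + 1 + 1), cpoch_succ l (j + k + 1)]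
  push_cast at *
  rw [add_comm (j : ℂ) m, show (j + 2 + m : ℂ) = m + (j + 2) by ring]
  have h₃' : m + ((j : ℂ) + k + 1 + 1) ≠ 0 := by convert h₃ using 1; ring
  field_simp
  ring

lemma gegenbauerCoeff_rec_zero_left (l : ℂ) {m : ℂ} (hm : 0 < m.re) (k : ℕ) :
    (2 * k + 2) * gegenbauerCoeff l m 0 (k + 1) =
      (2 * k + 1 + l) * (2 * m / (1 + m) * gegenbauerCoeff l m 1 k) -
        (2 * k + 2 * l) * gegenbauerCoeff l m 0 k := by
  have h₁ := cpoch_ne_zero hm k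
  have h₂ := add_natCast_ne_zero hm k
  have h₃ := add_natCast_ne_zero hm (k + 1)
  have h₅ := add_natCast_ne_zero hm 1
  have h₆ : (k.factorial : ℂ) ≠ 0 := by exact_mod_cast k.factorial_ne_zero
  have h₇ : (k + 1 : ℂ) ≠ 0 := by exact_mod_cast k.succ_ne_zero
  simp only [gegenbauerCoeff, Nat.factorial_succ, zero_add, add_comm 1 k, cpoch_succ]
  push_cast at *
  rw [add_comm (1 : ℂ) m]
  field_simp
  ring

lemma gegenbauerCoeff_rec_zero_right (l : ℂ) {m : ℂ} (hm : 0 < m.re) (j : ℕ) :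
    (j + 1) * gegenbauerCoeff l m (j + 1) 0 =
      (j + l) * ((j + 1) / (j + m) * gegenbauerCoeff l m j 0) := by
  have h₁ := cpoch_ne_zero hm j
  have h₂ := add_natCast_ne_zero hm j
  have h₃ := add_natCast_ne_zero hm (j + 1)
  simp only [gegenbauerCoeff, add_zero, cpoch_succ]
  push_cast at *
  rw [add_comm (j : ℂ) m]
  simp
  field_simp
  ring

/-- The `k`-th term of the expansion of `gegenbauer l x n` in the polynomials `gegenbauer m x`. -/
noncomputable def gegenbauerTerm (l m x : ℂ) (n k : ℕ) : ℂ :=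
  if 2 * k ≤ n then gegenbauerCoeff l m (n - 2 * k) k * gegenbauer m x (n - 2 * k) else 0

lemma gegenbauerTerm_add (l m x : ℂ) (j k : ℕ) :
    gegenbauerTerm l m x (j + 2 * k) k = gegenbauerCoeff l m j k * gegenbauer m x j := by
  simp [gegenbauerTerm]

lemma gegenbauerTerm_of_lt (l m x : ℂ) {n k : ℕ} (h : n < 2 * k) :
    gegenbauerTerm l m x n k = 0 := if_neg (by omega)

/-- The part of `2 * (n + l) * x * gegenbauerTerm l m x n k` that lowers the degree. -/
noncomputable def gegenbauerTermLower (l m x : ℂ) (n k : ℕ) : ℂ :=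
  if 2 * k < n then (n + l) * ((n - 2 * k - 1 + 2 * m) / (n - 2 * k + m)) *
    gegenbauerCoeff l m (n - 2 * k) k * gegenbauer m x (n - 2 * k - 1) else 0

lemma gegenbauerTermLower_add (l m x : ℂ) (j k : ℕ) :
    gegenbauerTermLower l m x (j + 1 + 2 * k) k =
      (j + 1 + 2 * k + l) * ((j + 2 * m) / (j + 1 + m)) *
        gegenbauerCoeff l m (j + 1) k * gegenbauer m x j := by
  rw [gegenbauerTermLower, if_pos (by omega), show j + 1 + 2 * k - 2 * k = j + 1 by omega,
    Nat.add_sub_cancel]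
  push_cast
  ring_nf

lemma gegenbauerTermLower_of_le (l m x : ℂ) {n k : ℕ} (h : n ≤ 2 * k) :
    gegenbauerTermLower l m x n k = 0 := if_neg (by omega)

lemma mul_gegenbauerTerm (l x : ℂ) {m : ℂ} (hm : 0 < m.re) (j k : ℕ) :
    2 * (j + 2 * k + l) * x * gegenbauerTerm l m x (j + 2 * k) k =
      (j + 2 * k + l) * ((j + 1) / (j + m)) * gegenbauerCoeff l m j k * gegenbauer m x (j + 1) +
        gegenbauerTermLower l m x (j + 2 * k) k := by
  rw [gegenbauerTerm_add]
  have h := add_natCast_ne_zero hm j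
  cases j with
  | zero =>
    rw [gegenbauerTermLower_of_le _ _ _ (by omega)]
    push_cast at *
    rw [add_zero] at h
    simp only [gegenbauer, zero_add]
    field_simp
    ring_nf
  | succ j =>
    rw [gegenbauerTermLower_add]
    have hg := gegenbauer_rec m x j
    push_cast at *
    rw [add_comm m] at h
    rw [show (j + 1 + 1 : ℂ) = j + 2 by ring]
    field_simp
    linear_combination (-(j + 1 + 2 * k + l) * gegenbauerCoeff l m (j + 1) k) * hg

lemma gegenbauerTerm_rec_zero (l x : ℂ) {m : ℂ} (hm : 0 < m.re) (n : ℕ) :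
    (n + 2) * gegenbauerTerm l m x (n + 2) 0 =
      2 * (n + 1 + l) * x * gegenbauerTerm l m x (n + 1) 0 -
        gegenbauerTermLower l m x (n + 1) 0 := by
  have h := mul_gegenbauerTerm l x hm (n + 1) 0
  have ht := gegenbauerTerm_add l m x (n + 2) 0
  have hc := gegenbauerCoeff_rec_zero_right l hm (n + 1)
  simp only [mul_zero, add_zero] at h ht
  push_cast at h hc
  rw [ht]
  simp only [mul_zero, add_zero, Nat.add_assoc, Nat.reduceAdd] at *
  linear_combination gegenbauer m x (n + 2) * hc - h

lemma gegenbauerTerm_rec_succ (l x : ℂ) {m : ℂ} (hm : 0 < m.re) (n k : ℕ) :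
    (n + 2) * gegenbauerTerm l m x (n + 2) (k + 1) =
      (2 * (n + 1 + l) * x * gegenbauerTerm l m x (n + 1) (k + 1) -
          gegenbauerTermLower l m x (n + 1) (k + 1)) +
        gegenbauerTermLower l m x (n + 1) k - (n + 2 * l) * gegenbauerTerm l m x n k := by
  rcases lt_or_ge n (2 * k) with hn | hn
  · rw [gegenbauerTerm_of_lt _ _ _ (by omega), gegenbauerTerm_of_lt _ _ _ (by omega),
      gegenbauerTerm_of_lt _ _ _ hn, gegenbauerTermLower_of_le _ _ _ (by omega),
      gegenbauerTermLower_of_le _ _ _ (by omega)]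
    ring
  obtain ⟨j, rfl⟩ := Nat.exists_eq_add_of_le' hn
  have ht := gegenbauerTerm_add l m x j (k + 1)
  have hl := gegenbauerTermLower_add l m x j k
  rw [show j + 2 * (k + 1) = j + 2 * k + 2 by ring] at ht
  rw [show j + 1 + 2 * k = j + 2 * k + 1 by ring] at hl
  rw [ht, hl, gegenbauerTerm_add]
  cases j with
  | zero =>
    rw [gegenbauerTerm_of_lt _ _ _ (by omega), gegenbauerTermLower_of_le _ _ _ (by omega)]
    have hc := gegenbauerCoeff_rec_zero_left l hm k
    push_cast
    simp only [zero_add]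
    linear_combination gegenbauer m x 0 * hc
  | succ j =>
    have h := mul_gegenbauerTerm l x hm j (k + 1)
    have hc := gegenbauerCoeff_rec l hm j k
    rw [show j + 2 * (k + 1) = j + 1 + 2 * k + 1 by ring] at h
    push_cast at h ⊢
    rw [show (j + 1 + 1 + m : ℂ) = j + 2 + m by ring]
    linear_combination gegenbauer m x (j + 1) * hc - h

/-- The connection formula for Gegenbauer polynomials. -/
lemma sum_gegenbauerTerm (l x : ℂ) {m : ℂ} (hm : 0 < m.re) (n N : ℕ) (hN : n < 2 * N) :
    ∑ k ∈ range N, gegenbauerTerm l m x n k = gegenbauer l x n := by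
  have hm₀ : m ≠ 0 := by simpa using add_natCast_ne_zero hm 0
  have hm₁ : m + 1 ≠ 0 := by simpa using add_natCast_ne_zero hm 1
  induction n using Nat.twoStepInduction generalizing N with
  | zero =>
    rw [sum_eq_single_of_mem 0 (mem_range.2 (by omega))
      fun k _ hk => gegenbauerTerm_of_lt _ _ _ (by omega)]
    simp [gegenbauerTerm, gegenbauerCoeff, gegenbauer, cpoch_succ, hm₀]
  | one =>
    rw [sum_eq_single_of_mem 0 (mem_range.2 (by omega))
      fun k _ hk => gegenbauerTerm_of_lt _ _ _ (by omega)]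
    simp [gegenbauerTerm, gegenbauerCoeff, gegenbauer, cpoch_succ]
    field_simp
  | more n ih₀ ih₁ =>
    obtain ⟨N, rfl⟩ : ∃ M, N = M + 1 := ⟨N - 1, by omega⟩
    have hn : (n + 2 : ℂ) ≠ 0 := by exact_mod_cast (n + 1).succ_ne_zero
    have hlow : ∑ k ∈ range (N + 1), gegenbauerTermLower l m x (n + 1) k =
        ∑ k ∈ range N, gegenbauerTermLower l m x (n + 1) k := by
      rw [sum_range_succ, gegenbauerTermLower_of_le _ _ _ (by omega), add_zero]
    have h₁ := ih₁ (N + 1) (by omega)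
    rw [sum_range_succ'] at h₁ hlow
    apply mul_left_cancel₀ hn
    rw [gegenbauer_rec, ← ih₀ N (by omega), ← h₁, sum_range_succ', mul_add, mul_sum,
      gegenbauerTerm_rec_zero l x hm, sum_congr rfl fun k _ => gegenbauerTerm_rec_succ l x hm n k]
    simp only [sum_add_distrib, sum_sub_distrib, ← mul_sum]
    linear_combination -hlow

lemma ferrersP_eq_gegenbauer (n : ℕ) (ν : ℂ) (hν : -(1 / 2 : ℝ) < ν.re) (x : ℝ)
    (hx : x ∈ Set.Ioo (-1 : ℝ) 1) :
    ferrersP (n + ν) ν x =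
      2 ^ ν * ((1 - x ^ 2 : ℝ) : ℂ) ^ (ν / 2) * n.factorial * Complex.Gamma (ν + 1 / 2) /
        (√Real.pi * Complex.Gamma (2 * ν + n + 1)) * gegenbauer (ν + 1 / 2) x n := by
  obtain ⟨hx₁, hx₂⟩ := hx
  have hp : 0 < 1 - x := by linarith
  have hq : 0 < 1 + x := by linarith
  have hν₁ : 0 < (ν + 1).re := by simp; linarith
  have hν₂ : 0 < (2 * ν + 1).re := by simp; linarith
  have hz : ‖(((1 - x) / 2 : ℝ) : ℂ)‖ < 1 := by
    rw [Complex.norm_real, Real.norm_eq_abs, abs_lt]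
    constructor <;> linarith
  have hF := hyp2F1_eq_gegenbauer ν hν hz n
  have hc := cpoch_ne_zero hν₂ n
  have hG₁ := Complex.Gamma_ne_zero_of_re_pos hν₁
  have hG₂ := Complex.Gamma_ne_zero_of_re_pos hν₂
  have hpi : ((√Real.pi : ℝ) : ℂ) ≠ 0 := by
    exact_mod_cast (Real.sqrt_pos.2 Real.pi_pos).ne'
  have hdup := Complex.Gamma_mul_Gamma_add_half (ν + 1 / 2)
  rw [show ν + 1 / 2 + 1 / 2 = ν + 1 by ring, show 2 * (ν + 1 / 2) = 2 * ν + 1 by ring,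
    show 1 - (2 * ν + 1) = -(ν + ν) by ring, Complex.cpow_neg,
    Complex.cpow_add _ _ two_ne_zero] at hdup
  have hpow : (((1 - x) / (1 + x) : ℝ) : ℂ) ^ (ν / 2) * (((1 + x) / 2 : ℝ) : ℂ) ^ ν * 2 ^ ν =
      ((1 - x ^ 2 : ℝ) : ℂ) ^ (ν / 2) := by
    rw [mul_assoc, show (2 : ℂ) = ((2 : ℝ) : ℂ) by norm_num,
      ← Complex.mul_cpow_ofReal_nonneg (by positivity) zero_le_two, ← Complex.ofReal_mul,
      div_mul_cancel₀ _ (two_ne_zero' ℝ)]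
    have : ((1 + x : ℝ) : ℂ) ^ ν = ((1 + x : ℝ) : ℂ) ^ (ν / 2) * ((1 + x : ℝ) : ℂ) ^ (ν / 2) := by
      rw [← Complex.cpow_add _ _ (by exact_mod_cast hq.ne'), add_halves]
    rw [Complex.ofReal_ofNat, this, ← mul_assoc,
      ← Complex.mul_cpow_ofReal_nonneg (by positivity) hq.le,
      ← Complex.ofReal_mul, div_mul_cancel₀ _ hq.ne',
      ← Complex.mul_cpow_ofReal_nonneg hp.le hq.le, ← Complex.ofReal_mul]
    ring_nf
  have h2 : (2 : ℂ) ^ ν ≠ 0 := by simp [Complex.cpow_eq_zero_iff]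
  rw [show (1 : ℂ) - (((1 - x) / 2 : ℝ) : ℂ) = (((1 + x) / 2 : ℝ) : ℂ) by push_cast; ring,
    show (1 : ℂ) - 2 * (((1 - x) / 2 : ℝ) : ℂ) = (x : ℂ) by push_cast; ring] at hF
  rw [ferrersP, show 2 * ν + n + 1 = 2 * ν + 1 + n by ring, Gamma_add_natCast hν₂, ← hpow,
    eq_div_of_mul_eq hc ((mul_comm _ _).trans hF)]
  clear hF hpow
  generalize Complex.Gamma (2 * ν + 1) = G₂ at *
  generalize Complex.Gamma (ν + 1) = G₁ at *
  generalize Complex.Gamma (ν + 1 / 2) = G at *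
  generalize cpoch (2 * ν + 1) n = p at *
  generalize gegenbauer (ν + 1 / 2) x n = g at *
  generalize ((√Real.pi : ℝ) : ℂ) = s at *
  generalize (2 : ℂ) ^ ν = t at *
  field_simp at hdup ⊢
  linear_combination (-(((1 - x) / (1 + x) : ℝ) : ℂ) ^ (ν / 2) * (((1 + x) / 2 : ℝ) : ℂ) ^ ν *
    n.factorial * g) * hdup

theorem ferrersP_connection (n : ℕ) (ν μ : ℂ) (hν : -(1 / 2 : ℝ) < ν.re)
    (hμ : -(1 / 2 : ℝ) < μ.re) (x : ℝ) (hx : x ∈ Set.Ioo (-1 : ℝ) 1) :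
    ferrersP ((n : ℂ) + ν) ν x =
      (2 : ℂ) ^ (ν - μ) * (Nat.factorial n : ℂ) * ((1 - x ^ 2 : ℝ) : ℂ) ^ ((ν - μ) / 2) /
          Complex.Gamma (2 * ν + n + 1) *
        ∑ k ∈ Finset.range (n / 2 + 1),
          (μ + n - 2 * k + 1 / 2) *
            (cpoch (ν - μ) k * Complex.Gamma (ν + 1 / 2 + n - k) *
                Complex.Gamma (2 * μ + n - 2 * k + 1) /
              ((Nat.factorial k : ℂ) * (Nat.factorial (n - 2 * k) : ℂ) *
                Complex.Gamma (μ + 3 / 2 + n - k))) *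
            ferrersP ((n : ℂ) - 2 * k + μ) μ x := by
  have hl : 0 < (ν + 1 / 2).re := by simp; linarith
  have hm : 0 < (μ + 1 / 2).re := by simp; linarith
  have hx' : 0 < 1 - x ^ 2 := by nlinarith [hx.1, hx.2]
  rw [ferrersP_eq_gegenbauer n ν hν x hx,
    ← sum_gegenbauerTerm (ν + 1 / 2) x hm n (n / 2 + 1) (by omega), mul_sum, mul_sum]
  refine sum_congr rfl fun k hk => ?_
  obtain ⟨j, rfl⟩ : ∃ j, n = j + 2 * k :=
    ⟨n - 2 * k, by have := mem_range.1 hk; omega⟩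
  rw [gegenbauerTerm_add, Nat.add_sub_cancel, gegenbauerCoeff]
  push_cast
  rw [show (j + 2 * k - 2 * k + μ : ℂ) = j + μ by ring, ferrersP_eq_gegenbauer j μ hμ x hx,
    show μ + (j + 2 * k) - 2 * k + 1 / 2 = μ + 1 / 2 + j by ring,
    show ν + 1 / 2 + (j + 2 * k) - k = ν + 1 / 2 + ((j + k : ℕ) : ℂ) by push_cast; ring,
    show 2 * μ + (j + 2 * k) - 2 * k + 1 = 2 * μ + j + 1 by ring,
    show μ + 3 / 2 + (j + 2 * k) - k = μ + 1 / 2 + ((j + k + 1 : ℕ) : ℂ) by push_cast; ring,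
    Gamma_add_natCast hl, Gamma_add_natCast hm,
    show ν + 1 / 2 - (μ + 1 / 2) = ν - μ by ring, sub_div,
    Complex.cpow_sub _ _ two_ne_zero, Complex.cpow_sub _ _ (by exact_mod_cast hx'.ne')]
  have h₁ := Complex.Gamma_ne_zero_of_re_pos hm
  have h₂ : Complex.Gamma (2 * μ + j + 1) ≠ 0 :=
    Complex.Gamma_ne_zero_of_re_pos (by simp; linarith [j.cast_nonneg (α := ℝ)])
  have h₃ := cpoch_ne_zero hm (j + k + 1)
  have h₄ : (2 : ℂ) ^ μ ≠ 0 := by simp [Complex.cpow_eq_zero_iff]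
  have h₅ : ((1 - x ^ 2 : ℝ) : ℂ) ^ (μ / 2) ≠ 0 := by
    simp only [ne_eq, Complex.cpow_eq_zero_iff, not_and_or]
    exact Or.inl (by exact_mod_cast hx'.ne')
  have h₆ : (j.factorial : ℂ) ≠ 0 := by exact_mod_cast j.factorial_ne_zero
  push_cast at h₅ ⊢
  generalize Complex.Gamma (2 * μ + j + 1) = G₁ at *
  generalize Complex.Gamma (μ + 1 / 2) = G₂ at *
  generalize Complex.Gamma (ν + 1 / 2) = G₃
  generalize Complex.Gamma (2 * ν + (j + 2 * k) + 1) = G₄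
  generalize cpoch (μ + 1 / 2) (j + k + 1) = p₁ at *
  generalize cpoch (ν + 1 / 2) (j + k) = p₂
  generalize cpoch (ν - μ) k = p₃
  generalize gegenbauer (μ + 1 / 2) x j = g
  generalize μ + 1 / 2 + (j : ℂ) = a
  generalize (2 : ℂ) ^ μ = t₁ at *
  generalize (2 : ℂ) ^ ν = t₂
  generalize (1 - (x : ℂ) ^ 2) ^ (μ / 2) = w₁ at *
  generalize (1 - (x : ℂ) ^ 2) ^ (ν / 2) = w₂
  field_simp
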